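/- arXiv:2003.11478 — 8 statements merged into one kernel-verified Lean document; each statement's English description precedes it below -/
import Mathlib

section
/- For t, h ∈ ℝ define the directional derivative a'(t; h) := a_i'(t)·h if t ∈ (t_i, t_{i+1}) for some 0 ≤ i ≤ K, and at a kink t_j (1 ≤ j ≤ K) define a'(t_j; h) := a_j'(t_j)·h if h ≥ 0 and a'(t_j; h) := a_{j−1}'(t_j)·h if h < 0. Then a is Hadamard directionally differentiable: for every t, h ∈ ℝ, every sequence of positive reals s_n → 0 and every sequence of reals h_n → h, one has (a(t + s_n·h_n) − a(t))/s_n → a'(t; h) as n → ∞. -/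
open Filter Set Topology

theorem HasDerivWithinAt.tendsto_quotient {f : ℝ → ℝ} {f' x h : ℝ} {S : Set ℝ}
    (hf : HasDerivWithinAt f f' S x) {ι : Type*} {l : Filter ι} {s d : ι → ℝ}
    (hs : ∀ n, 0 < s n) (hs0 : Tendsto s l (𝓝 0)) (hd : Tendsto d l (𝓝 h))
    (hS : ∀ᶠ n in l, x + s n * d n ∈ S) :
    Tendsto (fun n => (f (x + s n * d n) - f x) / s n) l (𝓝 (f' * h)) := by
  have hsd : Tendsto (fun n => s n * d n) l (𝓝 0) := by simpa using hs0.mul hd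
  have hcd : Tendsto (fun n => (s n)⁻¹ • (s n * d n)) l (𝓝 h) := by
    refine hd.congr fun n => ?_
    rw [smul_eq_mul, inv_mul_cancel_left₀ (hs n).ne']
  simpa [div_eq_inv_mul, mul_comm h] using
    hf.hasFDerivWithinAt.lim hsd hS hcd

/-- A function with one-sided derivatives is Hadamard directionally differentiable:
towards nonnegative directions the limit is governed by the right derivative. -/
theorem tendsto_quotient_of_nonneg {f : ℝ → ℝ} {L R x h : ℝ}
    (hL : HasDerivWithinAt f L (Iic x) x) (hR : HasDerivWithinAt f R (Ici x) x) (hh : 0 ≤ h)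
    {ι : Type*} {l : Filter ι} {s d : ι → ℝ}
    (hs : ∀ n, 0 < s n) (hs0 : Tendsto s l (𝓝 0)) (hd : Tendsto d l (𝓝 h)) :
    Tendsto (fun n => (f (x + s n * d n) - f x) / s n) l (𝓝 (R * h)) := by
  rcases hh.lt_or_eq with hh | rfl
  · refine hR.tendsto_quotient hs hs0 hd ?_
    filter_upwards [hd.eventually (lt_mem_nhds hh)] with n hn
    have := mul_pos (hs n) hn
    exact mem_Ici.2 (by linarith)
  · have hright : Tendsto (fun n => (f (x + s n * d n) - f x) / s n)
        (l ⊓ 𝓟 {n | 0 ≤ d n}) (𝓝 (R * 0)) := by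
      refine hR.tendsto_quotient hs (hs0.mono_left inf_le_left) (hd.mono_left inf_le_left) ?_
      filter_upwards [mem_inf_of_right (mem_principal_self _)] with n hn
      have := mul_nonneg (hs n).le hn
      exact mem_Ici.2 (by linarith)
    have hleft : Tendsto (fun n => (f (x + s n * d n) - f x) / s n)
        (l ⊓ 𝓟 {n | 0 ≤ d n}ᶜ) (𝓝 (L * 0)) := by
      refine hL.tendsto_quotient hs (hs0.mono_left inf_le_left) (hd.mono_left inf_le_left) ?_
      filter_upwards [mem_inf_of_right (mem_principal_self _)] with n hn
      have := mul_neg_of_pos_of_neg (hs n) (not_le.1 hn)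
      exact mem_Iic.2 (by linarith)
    rw [mul_zero] at hleft hright ⊢
    have hsup := hright.sup hleft
    rwa [← inf_sup_left, sup_principal, union_compl_self, principal_univ, inf_top_eq] at hsup

/-- The glued `PC¹` function `a` is Hadamard directionally differentiable:
for every point `x`, direction `h`, positive null sequence `s n → 0` and `hn n → h`,
the difference quotients `(a (x + s n * hn n) - a x) / s n` converge to the directional
derivative `a'(x; h)`, which equals `(a i)'(x)·h` when `x ∈ (t i, t (i+1))` (conventions
`t 0 = -∞`, `t (K+1) = +∞`), and at a kink `t j` equals `(a j)'(t j)·h` for `h ≥ 0`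
and `(a (j-1))'(t j)·h` for `h < 0`. -/
theorem pc1_hadamard_directionally_differentiable
    (K : ℕ) (hK : 1 ≤ K)
    (t : ℕ → ℝ) (ht : ∀ i, 1 ≤ i → i < K → t i < t (i + 1))
    (a : ℕ → ℝ → ℝ) (ha : ∀ i ≤ K, ContDiff ℝ 1 (a i))
    (hmatch : ∀ i, 1 ≤ i → i ≤ K → a (i - 1) (t i) = a i (t i))
    (A : ℝ → ℝ)
    (hA0 : ∀ s, s ≤ t 1 → A s = a 0 s)
    (hAmid : ∀ i, 1 ≤ i → i < K → ∀ s, t i < s → s ≤ t (i + 1) → A s = a i s)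
    (hAK : ∀ s, t K < s → A s = a K s) :
    (∀ i ≤ K, ∀ x h : ℝ, (1 ≤ i → t i < x) → (i < K → x < t (i + 1)) →
      ∀ s : ℕ → ℝ, (∀ n, 0 < s n) → Tendsto s atTop (𝓝 0) →
      ∀ hn : ℕ → ℝ, Tendsto hn atTop (𝓝 h) →
      Tendsto (fun n => (A (x + s n * hn n) - A x) / s n) atTop
        (𝓝 (deriv (a i) x * h))) ∧
    (∀ j, 1 ≤ j → j ≤ K → ∀ h : ℝ, 0 ≤ h →
      ∀ s : ℕ → ℝ, (∀ n, 0 < s n) → Tendsto s atTop (𝓝 0) →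
      ∀ hn : ℕ → ℝ, Tendsto hn atTop (𝓝 h) →
      Tendsto (fun n => (A (t j + s n * hn n) - A (t j)) / s n) atTop
        (𝓝 (deriv (a j) (t j) * h))) ∧
    (∀ j, 1 ≤ j → j ≤ K → ∀ h : ℝ, h < 0 →
      ∀ s : ℕ → ℝ, (∀ n, 0 < s n) → Tendsto s atTop (𝓝 0) →
      ∀ hn : ℕ → ℝ, Tendsto hn atTop (𝓝 h) →
      Tendsto (fun n => (A (t j + s n * hn n) - A (t j)) / s n) atTop
        (𝓝 (deriv (a (j - 1)) (t j) * h))) := by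
  have hglue : ∀ i ≤ K, ∀ y, (1 ≤ i → t i ≤ y) → (i < K → y ≤ t (i + 1)) → A y = a i y := by
    have hleft : ∀ i ≤ K, ∀ y, (1 ≤ i → t i < y) → (i < K → y ≤ t (i + 1)) →
        A y = a i y := by
      intro i hi y h1 h2
      rcases Nat.eq_zero_or_pos i with rfl | hpos
      · exact hA0 y (h2 hK)
      · rcases hi.lt_or_eq with hlt | rfl
        · exact hAmid i hpos hlt y (h1 hpos) (h2 hlt)
        · exact hAK y (h1 hpos)
    intro i hi y h1 h2
    by_cases hy : 1 ≤ i ∧ y = t i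
    · obtain ⟨hpos, rfl⟩ := hy
      rw [← hmatch i hpos hi]
      refine hleft (i - 1) (by omega) _ (fun h => ?_) (fun _ => ?_)
      · have := ht (i - 1) h (by omega)
        rwa [Nat.sub_add_cancel hpos] at this
      · rw [Nat.sub_add_cancel hpos]
    · exact hleft i hi y (fun h => lt_of_le_of_ne (h1 h) fun e => hy ⟨h, e.symm⟩) h2
  have hderiv : ∀ i ≤ K, ∀ x, HasDerivAt (a i) (deriv (a i) x) x := fun i hi x =>
    ((ha i hi).differentiable one_ne_zero x).hasDerivAt
  have hR : ∀ j, 1 ≤ j → j ≤ K →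
      HasDerivWithinAt A (deriv (a j) (t j)) (Ici (t j)) (t j) := by
    intro j hj hjK
    have hright : ∀ᶠ y in 𝓝 (t j), j < K → y ≤ t (j + 1) := by
      by_cases h : j < K
      · filter_upwards [gt_mem_nhds (ht j hj h)] with y hy _ using hy.le
      · exact Eventually.of_forall fun _ h' => absurd h' h
    refine (hderiv j hjK (t j)).hasDerivWithinAt.congr_of_eventuallyEq ?_
      (hglue j hjK _ (fun _ => le_rfl) fun h => (ht j hj h).le)
    filter_upwards [self_mem_nhdsWithin, nhdsWithin_le_nhds hright] with y hy hy'
    exact hglue j hjK y (fun _ => hy) hy'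
  have hL : ∀ j, 1 ≤ j → j ≤ K →
      HasDerivWithinAt A (deriv (a (j - 1)) (t j)) (Iic (t j)) (t j) := by
    intro j hj hjK
    have hlt : 1 ≤ j - 1 → t (j - 1) < t j := fun h => by
      have := ht (j - 1) h (by omega)
      rwa [Nat.sub_add_cancel hj] at this
    have hleft : ∀ᶠ y in 𝓝 (t j), 1 ≤ j - 1 → t (j - 1) ≤ y := by
      by_cases h : 1 ≤ j - 1
      · filter_upwards [lt_mem_nhds (hlt h)] with y hy _ using hy.le
      · exact Eventually.of_forall fun _ h' => absurd h' h
    have hsucc : t (j - 1 + 1) = t j := by rw [Nat.sub_add_cancel hj]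
    refine (hderiv (j - 1) (by omega) (t j)).hasDerivWithinAt.congr_of_eventuallyEq ?_
      (hglue (j - 1) (by omega) _ (fun h => (hlt h).le) fun _ => hsucc.ge)
    filter_upwards [self_mem_nhdsWithin, nhdsWithin_le_nhds hleft] with y hy hy'
    exact hglue (j - 1) (by omega) y hy' fun _ => hsucc ▸ hy
  refine ⟨fun i hi x h h1 h2 s hs hs0 d hd => ?_, fun j hj hjK h hh s hs hs0 d hd =>
    tendsto_quotient_of_nonneg (hL j hj hjK) (hR j hj hjK) hh hs hs0 hd,
    fun j hj hjK h hh s hs hs0 d hd => (hL j hj hjK).tendsto_quotient hs hs0 hd ?_⟩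
  · have hleft : ∀ᶠ y in 𝓝 x, 1 ≤ i → t i ≤ y := by
      by_cases h : 1 ≤ i
      · filter_upwards [lt_mem_nhds (h1 h)] with y hy _ using hy.le
      · exact Eventually.of_forall fun _ h' => absurd h' h
    have hright : ∀ᶠ y in 𝓝 x, i < K → y ≤ t (i + 1) := by
      by_cases h : i < K
      · filter_upwards [gt_mem_nhds (h2 h)] with y hy _ using hy.le
      · exact Eventually.of_forall fun _ h' => absurd h' h
    have hA : HasDerivAt A (deriv (a i) x) x := by
      refine (hderiv i hi x).congr_of_eventuallyEq ?_
      filter_upwards [hleft, hright] with y using hglue i hi y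
    exact (hA.hasDerivWithinAt (s := univ)).tendsto_quotient hs hs0 hd (by simp)
  · filter_upwards [hd.eventually (gt_mem_nhds hh)] with n hn
    have := mul_neg_of_pos_of_neg (hs n) hn
    exact mem_Iic.2 (by linarith)
end

section
/- Let t̂ ∈ ℝ, δ > 0, and κ, r ≥ 0 with κ < δ. Let u₁, u₂, v ∈ ℝ satisfy |u₁ − v| ≤ κ, |u₂ − v| ≤ κ, and |u₁ − u₂| ≤ r. For w ∈ ℝ define χ(w) := t̂ − w if both t̂ < v < t̂ + δ and t̂ − δ < w ≤ t̂, and χ(w) := 0 otherwise. Then: if 0 < v − t̂ ≤ κ one has |χ(u₁) − χ(u₂)| ≤ 2r, and otherwise χ(u₁) = χ(u₂) = 0. -/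
open Filter Set Topology
open scoped Classical

/-- Pointwise estimate near a kink value `t̂`: with
`χ(w) := t̂ - w` if `t̂ < v < t̂ + δ` and `t̂ - δ < w ≤ t̂`, and `χ(w) := 0` otherwise,
for `|u₁ - v| ≤ κ`, `|u₂ - v| ≤ κ`, `|u₁ - u₂| ≤ r` (with `0 ≤ κ < δ`, `0 ≤ r`):
if `0 < v - t̂ ≤ κ` then `|χ u₁ - χ u₂| ≤ 2r`, and otherwise `χ u₁ = χ u₂ = 0`. -/
theorem kink_indicator_difference_estimate
    (that δ κ r : ℝ) (hδ : 0 < δ) (hκ : 0 ≤ κ) (hr : 0 ≤ r) (hκδ : κ < δ)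
    (u₁ u₂ v : ℝ) (h1 : |u₁ - v| ≤ κ) (h2 : |u₂ - v| ≤ κ) (h3 : |u₁ - u₂| ≤ r) :
    let χ : ℝ → ℝ := fun w =>
      if that < v ∧ v < that + δ ∧ that - δ < w ∧ w ≤ that then that - w else 0
    ((0 < v - that ∧ v - that ≤ κ) → |χ u₁ - χ u₂| ≤ 2 * r) ∧
    (¬(0 < v - that ∧ v - that ≤ κ) → χ u₁ = 0 ∧ χ u₂ = 0) := by
  intro χ
  rw [abs_le] at h1 h2 h3
  constructor
  · rintro ⟨hv, hvκ⟩
    rw [abs_le]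
    simp only [χ]
    split_ifs <;> grind
  · intro h
    constructor <;> refine if_neg ?_ <;> rintro ⟨hv, -, -, hu⟩ <;>
      exact h ⟨by linarith, by linarith⟩
end

section
/- For w, v ∈ ℝ and 0 ≤ i ≤ K define ζ_i(w, v) as the sum of the following two terms: (a_{i−1}'(t_i) − a_i'(t_i))·(t_i − w) if t_i < v < t_i + δ and t_i − δ < w ≤ t_i (this term is absent for i = 0), and (a_{i+1}'(t_{i+1}) − a_i'(t_{i+1}))·(t_{i+1} − w) if t_{i+1} − δ < v < t_{i+1} and t_{i+1} ≤ w < t_{i+1} + δ (this term is absent for i = K). Then for every κ with 0 < κ < δ and all w, v ∈ ℝ with |w − v| ≤ κ one has Σ_{i=0}^{K} |ζ_i(w, v)| ≤ κ · Σ_{i=1}^{K} σ_i · 𝟙{0 < |v − t_i| ≤ κ}. -/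
open Filter Set Topology
open scoped Classical

/-- The curvature integrand `ζ_i(w, v)`: the sum of
`(a_{i-1}'(t i) - a_i'(t i))·(t i - w)` on the set `{t i < v < t i + δ, t i - δ < w ≤ t i}`
(absent for `i = 0`) and `(a_{i+1}'(t (i+1)) - a_i'(t (i+1)))·(t (i+1) - w)` on the set
`{t (i+1) - δ < v < t (i+1), t (i+1) ≤ w < t (i+1) + δ}` (absent for `i = K`). -/
noncomputable def zetaFun (K : ℕ) (t : ℕ → ℝ) (a : ℕ → ℝ → ℝ) (δ : ℝ)
    (i : ℕ) (w v : ℝ) : ℝ :=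
  (if i ≠ 0 ∧ t i < v ∧ v < t i + δ ∧ t i - δ < w ∧ w ≤ t i
    then (deriv (a (i - 1)) (t i) - deriv (a i) (t i)) * (t i - w) else 0) +
  (if i ≠ K ∧ t (i + 1) - δ < v ∧ v < t (i + 1) ∧ t (i + 1) ≤ w ∧ w < t (i + 1) + δ
    then (deriv (a (i + 1)) (t (i + 1)) - deriv (a i) (t (i + 1))) * (t (i + 1) - w) else 0)

/-- The two terms of the curvature integrands attached to a single exceptional point `s`, with
jump coefficient `c`, are together bounded by `κ * |c|`, and they vanish unless
`0 < |v - s| ≤ κ`. -/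
theorem abs_jump_terms_le {κ δ w v s : ℝ} (c : ℝ) (hκ : 0 < κ) (hwv : |w - v| ≤ κ) :
    |if s < v ∧ v < s + δ ∧ s - δ < w ∧ w ≤ s then c * (s - w) else 0| +
      |if s - δ < v ∧ v < s ∧ s ≤ w ∧ w < s + δ then -c * (s - w) else 0| ≤
    κ * (|c| * (if 0 < |v - s| ∧ |v - s| ≤ κ then 1 else 0)) := by
  obtain ⟨hl, hr⟩ := abs_le.mp hwv
  by_cases h1 : s < v ∧ v < s + δ ∧ s - δ < w ∧ w ≤ s
  · obtain ⟨hsv, -, -, hws⟩ := id h1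
    have h2 : ¬(s - δ < v ∧ v < s ∧ s ≤ w ∧ w < s + δ) := fun h => by linarith [h.2.1]
    have h3 : 0 < |v - s| ∧ |v - s| ≤ κ := by
      rw [abs_of_pos (sub_pos.mpr hsv)]
      constructor <;> linarith
    rw [if_pos h1, if_neg h2, if_pos h3, abs_zero, add_zero, mul_one, abs_mul, mul_comm κ]
    gcongr
    rw [abs_le]
    constructor <;> linarith
  · rw [if_neg h1, abs_zero, zero_add]
    by_cases h2 : s - δ < v ∧ v < s ∧ s ≤ w ∧ w < s + δ
    · obtain ⟨-, hvs, hsw, -⟩ := id h2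
      have h3 : 0 < |v - s| ∧ |v - s| ≤ κ := by
        rw [abs_of_neg (sub_neg.mpr hvs)]
        constructor <;> linarith
      rw [if_pos h2, if_pos h3, mul_one, abs_mul, abs_neg, mul_comm κ]
      gcongr
      rw [abs_le]
      constructor <;> linarith
    · rw [if_neg h2, abs_zero]
      positivity

/-- For every `0 < κ < δ` and all `w, v` with `|w - v| ≤ κ`,
`∑_{i=0}^{K} |ζ_i(w, v)| ≤ κ · ∑_{i=1}^{K} σ_i · 𝟙{0 < |v - t i| ≤ κ}`,
where `σ_i = |a_{i-1}'(t i) - a_i'(t i)|`. -/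
theorem zeta_sum_estimate
    (K : ℕ) (hK : 1 ≤ K)
    (t : ℕ → ℝ) (ht : ∀ i, 1 ≤ i → i < K → t i < t (i + 1))
    (a : ℕ → ℝ → ℝ) (ha : ∀ i ≤ K, ContDiff ℝ 1 (a i))
    (hmatch : ∀ i, 1 ≤ i → i ≤ K → a (i - 1) (t i) = a i (t i))
    (δ : ℝ) (hδ : 0 < δ) (hδ2 : ∀ i, 1 ≤ i → i < K → δ ≤ (t (i + 1) - t i) / 2) :
    ∀ κ : ℝ, 0 < κ → κ < δ → ∀ w v : ℝ, |w - v| ≤ κ →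
      ∑ i ∈ Finset.range (K + 1), |zetaFun K t a δ i w v| ≤
        κ * ∑ i ∈ Finset.Icc 1 K,
          |deriv (a (i - 1)) (t i) - deriv (a i) (t i)| *
            (if 0 < |v - t i| ∧ |v - t i| ≤ κ then 1 else 0) := by
  intro κ hκ _ w v hwv
  have hIcc : Finset.Icc 1 K = Finset.Ico 1 (K + 1) := by
    ext j
    simp only [Finset.mem_Icc, Finset.mem_Ico]
    omega
  rw [hIcc, Finset.sum_Ico_eq_sum_range, Nat.add_sub_cancel, Finset.mul_sum]
  refine (Finset.sum_le_sum fun i _ => abs_add_le _ _).trans ?_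
  rw [Finset.sum_add_distrib, Finset.sum_range_succ', Finset.sum_range_succ _ K]
  simp only [ne_eq, not_true_eq_false, false_and, if_false, abs_zero, add_zero]
  rw [← Finset.sum_add_distrib]
  refine Finset.sum_le_sum fun j hj => ?_
  have hjK : j ≠ K := (Finset.mem_range.mp hj).ne
  have key := abs_jump_terms_le (δ := δ) (s := t (j + 1))
    (deriv (a j) (t (j + 1)) - deriv (a (j + 1)) (t (j + 1))) hκ hwv
  rw [neg_sub] at key
  simpa [add_comm 1 j, hjK] using key
end

section
/- Let y : ℝ → ℝ be Lipschitz continuous, let c, t ∈ ℝ and ε > 0, and assume that y is monotonically increasing on [c, c+ε] with y(c) = t and y(c+ε) > t. Then lim_{r→0⁺} (1/r) ∫_{(c, c+ε)} 𝟙{0 < |y(x) − t| < r} · |y'(x)| dx = 1, where y' denotes the almost-everywhere defined derivative of the Lipschitz function y. -/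
open Filter Set Topology MeasureTheory
open scoped Classical

/-- A continuous monotone function on `[c, d]` maps exactly a subinterval `(a, b)` of `(c, d)` into
the open band `(u, v)` between two values `u < v` it attains, and attains them at `a` and `b`. -/
theorem MonotoneOn.exists_Ioo_inter_preimage_Ioo_eq {y : ℝ → ℝ} {c d u v : ℝ} (hcd : c ≤ d)
    (hmono : MonotoneOn y (Icc c d)) (hcont : ContinuousOn y (Icc c d))
    (hu : u ∈ Icc (y c) (y d)) (hv : v ∈ Icc (y c) (y d)) (huv : u < v) :
    ∃ a b, a ≤ b ∧ a ∈ Icc c d ∧ b ∈ Icc c d ∧ y a = u ∧ y b = v ∧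
      Ioo c d ∩ y ⁻¹' Ioo u v = Ioo a b := by
  have hcompact (w : ℝ) : IsCompact (Icc c d ∩ y ⁻¹' {w}) :=
    isCompact_Icc.of_isClosed_subset
      (hcont.preimage_isClosed_of_isClosed isClosed_Icc isClosed_singleton) inter_subset_left
  have hne {w : ℝ} (hw : w ∈ Icc (y c) (y d)) : (Icc c d ∩ y ⁻¹' {w}).Nonempty := by
    obtain ⟨x, hx, hxw⟩ := intermediate_value_Icc hcd hcont hw
    exact ⟨x, hx, hxw⟩
  obtain ⟨a, ⟨ha, hya⟩, hamax⟩ := (hcompact u).exists_isGreatest (hne hu)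
  obtain ⟨b, ⟨hb, hyb⟩, hbmin⟩ := (hcompact v).exists_isLeast (hne hv)
  rw [mem_preimage, mem_singleton_iff] at hya hyb
  have hab : a ≤ b := by
    by_contra! h
    linarith [hmono hb ha h.le]
  refine ⟨a, b, hab, ha, hb, hya, hyb, ?_⟩
  ext x
  constructor
  · rintro ⟨hx, hux, hxv⟩
    have hx' := Ioo_subset_Icc_self hx
    constructor
    · by_contra! h
      linarith [hmono hx' ha h]
    · by_contra! h
      linarith [hmono hb hx' h]
  · rintro ⟨hax, hxb⟩
    have hx : x ∈ Ioo c d := ⟨ha.1.trans_lt hax, hxb.trans_le hb.2⟩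
    have hx' := Ioo_subset_Icc_self hx
    refine ⟨hx, lt_of_le_of_ne (hya ▸ hmono ha hx' hax.le) fun h => ?_,
      lt_of_le_of_ne (hyb ▸ hmono hx' hb hxb.le) fun h => ?_⟩
    · exact hax.not_ge (hamax ⟨hx', h.symm⟩)
    · exact hxb.not_ge (hbmin ⟨hx', h⟩)

/-- The total variation of a monotone absolutely continuous function, as the integral of the
absolute value of its derivative. -/
theorem MonotoneOn.setIntegral_Ioo_abs_deriv_eq_sub {y : ℝ → ℝ} {a b : ℝ} (hab : a ≤ b)
    (hmono : MonotoneOn y (Icc a b)) (hy : AbsolutelyContinuousOnInterval y a b) :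
    ∫ x in Ioo a b, |deriv y x| = y b - y a := by
  have hderiv : ∀ x ∈ Ioo a b, |deriv y x| = deriv y x := fun x hx => by
    rw [← derivWithin_of_mem_nhds (Icc_mem_nhds hx.1 hx.2)]
    exact abs_of_nonneg hmono.derivWithin_nonneg
  rw [setIntegral_congr_fun measurableSet_Ioo hderiv, ← integral_Ioc_eq_integral_Ioo,
    ← intervalIntegral.integral_of_le hab, hy.integral_deriv_eq_sub]

/-- The part of the variation of a monotone Lipschitz function on `(c, d)` that lies in the band
`(u, v)` of attained values is the width of the band. -/
theorem LipschitzOnWith.setIntegral_abs_deriv_preimage_Ioo {y : ℝ → ℝ} {L : NNReal}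
    {c d u v : ℝ} (hcd : c ≤ d) (hy : LipschitzOnWith L y (Icc c d))
    (hmono : MonotoneOn y (Icc c d)) (hu : u ∈ Icc (y c) (y d)) (hv : v ∈ Icc (y c) (y d))
    (huv : u < v) :
    ∫ x in Ioo c d ∩ y ⁻¹' Ioo u v, |deriv y x| = v - u := by
  obtain ⟨a, b, hab, ha, hb, rfl, rfl, h⟩ :=
    hmono.exists_Ioo_inter_preimage_Ioo_eq hcd hy.continuousOn hu hv huv
  have hsub : Icc a b ⊆ Icc c d := Icc_subset_Icc ha.1 hb.2
  rw [h, (hmono.mono hsub).setIntegral_Ioo_abs_deriv_eq_sub hab]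
  exact (hy.mono (by rwa [uIcc_of_le hab])).absolutelyContinuousOnInterval

/-- For a Lipschitz function `y` that is monotonically increasing on
`[c, c+ε]` with `y c = t` and `y (c+ε) > t`, the normalized level-band integrals converge:
`(1/r) ∫_{(c, c+ε)} 𝟙{0 < |y x - t| < r} |y' x| dx → 1` as `r → 0⁺`. -/
theorem level_band_integral_limit_one
    (y : ℝ → ℝ) (hy : ∃ L : NNReal, LipschitzWith L y)
    (c t ε : ℝ) (hε : 0 < ε)
    (hmono : MonotoneOn y (Set.Icc c (c + ε)))
    (hyc : y c = t) (hyce : t < y (c + ε)) :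
    Tendsto (fun r : ℝ =>
        (1 / r) * ∫ x in Set.Ioo c (c + ε),
          (if 0 < |y x - t| ∧ |y x - t| < r then |deriv y x| else 0))
      (𝓝[>] (0 : ℝ)) (𝓝 1) := by
  obtain ⟨L, hL⟩ := hy
  have hcd : c ≤ c + ε := by linarith
  refine tendsto_const_nhds.congr' ?_
  filter_upwards [Ioo_mem_nhdsGT (sub_pos.2 hyce)] with r hr
  have hindicator : EqOn
      (fun x => if 0 < |y x - t| ∧ |y x - t| < r then |deriv y x| else 0)
      ((y ⁻¹' Ioo t (t + r)).indicator fun x => |deriv y x|) (Ioo c (c + ε)) := fun x hx => by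
    have htx : t ≤ y x :=
      hyc ▸ hmono (left_mem_Icc.2 hcd) (Ioo_subset_Icc_self hx) hx.1.le
    simp only [indicator_apply, mem_preimage, mem_Ioo, abs_of_nonneg (sub_nonneg.2 htx), sub_pos,
      sub_lt_iff_lt_add']
  rw [setIntegral_congr_fun measurableSet_Ioo hindicator,
    setIntegral_indicator (hL.continuous.measurable measurableSet_Ioo),
    hL.lipschitzOnWith.setIntegral_abs_deriv_preimage_Ioo hcd hmono
      ⟨hyc.le, hyce.le⟩ ⟨by linarith [hr.1], by linarith [hr.2]⟩ (by linarith [hr.1]),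
    add_sub_cancel_left, one_div_mul_cancel hr.1.ne']
end

section
/- Let y : ℝ → ℝ be Lipschitz continuous, let c, t ∈ ℝ and ε > 0, and assume that y is monotonically increasing on [c, c+ε] with y(c) = t. Then for every r with 0 < r < y(c+ε) − t one has ∫_{(c, c+ε)} 𝟙{t < y(x) < t + r} · y'(x) dx = r, where y' denotes the almost-everywhere defined derivative of the Lipschitz function y. -/
open Filter Set Topology MeasureTheory
open scoped Classical

/-- A strict level band of a continuous monotone function on a compact interval is an open
interval whose endpoints attain the bounding levels. -/
lemma exists_Ioo_eq_level_band {y : ℝ → ℝ} {c d u v : ℝ} (hcd : c ≤ d)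
    (hcont : ContinuousOn y (Icc c d)) (hmono : MonotoneOn y (Icc c d))
    (huv : u < v) (hu : y c ≤ u) (hv : v ≤ y d) :
    ∃ a ∈ Icc c d, ∃ b ∈ Icc c d, a ≤ b ∧ y a = u ∧ y b = v ∧
      {x ∈ Ioo c d | u < y x ∧ y x < v} = Ioo a b := by
  have hcompact (s : ℝ) : IsCompact (Icc c d ∩ y ⁻¹' {s}) :=
    isCompact_Icc.of_isClosed_subset
      (hcont.preimage_isClosed_of_isClosed isClosed_Icc isClosed_singleton) inter_subset_left
  have hne (s : ℝ) (hs : s ∈ Icc (y c) (y d)) : (Icc c d ∩ y ⁻¹' {s}).Nonempty :=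
    intermediate_value_Icc hcd hcont hs
  obtain ⟨a, ⟨ha, hya⟩, hamax⟩ := (hcompact u).exists_isGreatest (hne u ⟨hu, huv.le.trans hv⟩)
  obtain ⟨b, ⟨hb, hyb⟩, hbmin⟩ := (hcompact v).exists_isLeast (hne v ⟨hu.trans huv.le, hv⟩)
  simp only [mem_preimage, mem_singleton_iff] at hya hyb
  refine ⟨a, ha, b, hb, ?_, hya, hyb, ?_⟩
  · by_contra! h
    have := hmono hb ha h.le
    linarith
  · ext x
    constructor
    · rintro ⟨hx, hux, hxv⟩
      have hx' := Ioo_subset_Icc_self hx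
      constructor
      · by_contra! h
        have := hmono hx' ha h
        linarith
      · by_contra! h
        have := hmono hb hx' h
        linarith
    · rintro ⟨hax, hxb⟩
      have hx : x ∈ Ioo c d := ⟨ha.1.trans_lt hax, hxb.trans_le hb.2⟩
      have hx' := Ioo_subset_Icc_self hx
      refine ⟨hx, lt_of_le_of_ne (hya ▸ hmono ha hx' hax.le) fun h => ?_,
        lt_of_le_of_ne (hyb ▸ hmono hx' hb hxb.le) fun h => ?_⟩
      · exact hax.not_ge (hamax ⟨hx', h.symm⟩)
      · exact hxb.not_ge (hbmin ⟨hx', h⟩)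

/-- For a Lipschitz function `y` that is monotonically increasing on
`[c, c+ε]` with `y c = t`, the integral of its a.e. derivative over the sublevel band
`{t < y < t + r}` inside `(c, c+ε)` equals exactly `r` for every `0 < r < y (c+ε) - t`. -/
theorem level_band_integral_identity
    (y : ℝ → ℝ) (hy : ∃ L : NNReal, LipschitzWith L y)
    (c t ε : ℝ) (hε : 0 < ε)
    (hmono : MonotoneOn y (Set.Icc c (c + ε)))
    (hyc : y c = t) :
    ∀ r : ℝ, 0 < r → r < y (c + ε) - t →
      (∫ x in Set.Ioo c (c + ε),
        (if t < y x ∧ y x < t + r then deriv y x else 0)) = r := by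
  intro r hr hr'
  obtain ⟨L, hL⟩ := hy
  obtain ⟨a, -, b, -, hab, hya, hyb, hband⟩ :=
    exists_Ioo_eq_level_band (u := t) (v := t + r) (by linarith) hL.continuous.continuousOn hmono
      (by linarith) hyc.le (by linarith)
  have hmeas : MeasurableSet {x | t < y x ∧ y x < t + r} :=
    hL.continuous.measurable measurableSet_Ioo
  calc ∫ x in Ioo c (c + ε), (if t < y x ∧ y x < t + r then deriv y x else 0)
      = ∫ x in Ioo c (c + ε), {x | t < y x ∧ y x < t + r}.indicator (deriv y) x := by
        simp only [indicator_apply, mem_ofPred_eq]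
    _ = ∫ x in Ioo a b, deriv y x := by
        rw [setIntegral_indicator hmeas, ← hband]
        rfl
    _ = ∫ x in a..b, deriv y x := by
        rw [intervalIntegral.integral_of_le hab, integral_Ioc_eq_integral_Ioo]
    _ = y b - y a :=
        (hL.lipschitzOnWith (s := uIcc a b)).absolutelyContinuousOnInterval.integral_deriv_eq_sub
    _ = r := by rw [hya, hyb]; ring
end

section
/- Assume y : ℝ → ℝ is Lipschitz continuous, and assume that the set y^{−1}(E_a) ∩ [α₀, β₀] is a union ⋃_{j∈J} [x̲_j, x̄_j] of finitely many pairwise disjoint nonempty closed intervals [x̲_j, x̄_j] ⊆ [α₀, β₀] (x̲_j ≤ x̄_j), and that for every j ∈ J: if x̄_j < β₀ there exists ε > 0 such that y is monotone (monotonically increasing or monotonically decreasing) on [x̄_j, x̄_j + ε] ⊆ [α₀, β₀], and if x̲_j > α₀ there exists ε > 0 such that y is monotone on [x̲_j − ε, x̲_j] ⊆ [α₀, β₀]. Assume moreover σ_i > 0 for all 1 ≤ i ≤ K. Then (card(J) − 1)·min_{1≤i≤K} σ_i ≤ Σ(y) ≤ 2·card(J)·max_{1≤i≤K} σ_i. 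-/
open Filter Set Topology MeasureTheory
open scoped ENNReal
open scoped Classical

/-- The one-dimensional jump functional
`Σ(y) = limsup_{r→0⁺} (1/r) ∑_{i=1}^{K} σ i ∫_Ω 𝟙{0 < |y x - t i| ≤ r} |y' x| dx ∈ [0,∞]`
on `Ω = (α₀, β₀)`, where `y'` is the a.e. derivative of the Lipschitz function `y`. -/
noncomputable def jumpFunctional (K : ℕ) (t : ℕ → ℝ) (σ : ℕ → ℝ) (α₀ β₀ : ℝ)
    (y : ℝ → ℝ) : ℝ≥0∞ :=
  Filter.limsup (fun r : ℝ => ENNReal.ofReal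
      ((1 / r) * ∑ i ∈ Finset.Icc 1 K, σ i *
        ∫ x in Set.Ioo α₀ β₀,
          (if 0 < |y x - t i| ∧ |y x - t i| ≤ r then |deriv y x| else 0)))
    (𝓝[>] (0 : ℝ))

/-- The integrand `𝟙{0 < |f x - c| ≤ r} |f' x|` of the jump functional. -/
noncomputable def levelIntegrand (f : ℝ → ℝ) (c r x : ℝ) : ℝ :=
  if 0 < |f x - c| ∧ |f x - c| ≤ r then |deriv f x| else 0

lemma levelIntegrand_neg (f : ℝ → ℝ) (c r x : ℝ) :
    levelIntegrand (fun z => -f z) (-c) r x = levelIntegrand f c r x := by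
  have h : |-f x - -c| = |f x - c| := by rw [← abs_neg]; congr 1; ring
  simp only [levelIntegrand, h, deriv.fun_neg, abs_neg]

lemma levelIntegrand_comp_neg (f : ℝ → ℝ) (c r x : ℝ) :
    levelIntegrand (fun z => f (-z)) c r x = levelIntegrand f c r (-x) := by
  simp only [levelIntegrand, deriv_comp_neg, abs_neg]

lemma integrableOn_levelIntegrand {f : ℝ → ℝ} {L : NNReal} (hf : LipschitzWith L f) (c r : ℝ)
    {s : Set ℝ} (hs : volume s ≠ ∞) : IntegrableOn (levelIntegrand f c r) s := by
  have hm : Measurable fun x => |f x - c| := by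
    have := hf.continuous
    fun_prop
  refine Measure.integrableOn_of_bounded (M := L) hs ?_ ?_
  · refine (Measurable.ite ?_ ?_ measurable_const).aestronglyMeasurable
    · exact (measurableSet_lt measurable_const hm).inter (measurableSet_le hm measurable_const)
    · exact (measurable_deriv f).abs
  · refine Eventually.of_forall fun x => ?_
    have h := norm_deriv_le_of_lipschitz (x₀ := x) hf
    unfold levelIntegrand
    split_ifs
    · simpa using h
    · simp

lemma setIntegral_Ioo_levelIntegrand_of_monotoneOn {f : ℝ → ℝ} {L : NNReal}
    (hf : LipschitzWith L f) {c d : ℝ} (hcd : c < d) (hmono : MonotoneOn f (Icc c d))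
    (hne : ∀ x ∈ Ioo c d, f x ≠ f c) :
    ∀ᶠ r in 𝓝[>] (0 : ℝ), ∫ x in Ioo c d, levelIntegrand f (f c) r x = r := by
  have hgt : ∀ x ∈ Ioo c d, f c < f x := fun x hx =>
    lt_of_le_of_ne (hmono (left_mem_Icc.2 hcd.le) (Ioo_subset_Icc_self hx) hx.1.le)
      (hne x hx).symm
  have hlt : f c < f d := by
    have hmid : (c + d) / 2 ∈ Ioo c d := ⟨by linarith, by linarith⟩
    exact (hgt _ hmid).trans_le
      (hmono (Ioo_subset_Icc_self hmid) (right_mem_Icc.2 hcd.le) hmid.2.le)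
  filter_upwards [Ioo_mem_nhdsGT (sub_pos.2 hlt)] with r hr
  obtain ⟨hr0, hrd⟩ := hr
  obtain ⟨z, hz, hfz⟩ := intermediate_value_Icc hcd.le hf.continuous.continuousOn
    (show f c + r ∈ Icc (f c) (f d) from ⟨by linarith, by linarith⟩)
  have hcpt : IsCompact {x | x ∈ Icc c d ∧ f x ≤ f c + r} :=
    isCompact_Icc.inter_right (isClosed_le hf.continuous continuous_const)
  obtain ⟨e, ⟨hecd, hfe⟩, hmax⟩ := hcpt.exists_isGreatest ⟨z, hz, hfz.le⟩
  have hze : z ≤ e := hmax ⟨hz, hfz.le⟩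
  have hfe' : f e = f c + r := le_antisymm hfe (hfz ▸ hmono hz hecd hze)
  have hce : c < e := lt_of_le_of_ne hecd.1 fun h => by rw [← h] at hfe'; linarith
  have hed : e < d := lt_of_le_of_ne hecd.2 fun h => by rw [h] at hfe'; linarith
  calc ∫ x in Ioo c d, levelIntegrand f (f c) r x
      = ∫ x in Ioc c e, levelIntegrand f (f c) r x := by
        refine (setIntegral_eq_of_subset_of_forall_sdiff_eq_zero measurableSet_Ioo
          (fun x hx => ⟨hx.1, hx.2.trans_lt hed⟩) fun x hx => if_neg fun h => ?_)
        have hxe : e < x := by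
          by_contra! hle
          exact hx.2 ⟨hx.1.1, hle⟩
        exact hxe.not_ge (hmax ⟨Ioo_subset_Icc_self hx.1, by
          linarith [le_abs_self (f x - f c), h.2]⟩)
    _ = ∫ x in Ioo c e, levelIntegrand f (f c) r x := integral_Ioc_eq_integral_Ioo
    _ = ∫ x in Ioo c e, deriv f x := by
        refine setIntegral_congr_fun measurableSet_Ioo fun x hx => ?_
        have hx' : x ∈ Ioo c d := ⟨hx.1, hx.2.trans hed⟩
        have h1 := hgt x hx'
        have h2 := hmono (Ioo_subset_Icc_self hx') hecd hx.2.le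
        have h3 : 0 ≤ deriv f x := by
          rw [← derivWithin_of_mem_nhds (Icc_mem_nhds hx'.1 hx'.2)]
          exact hmono.derivWithin_nonneg
        have h4 : |f x - f c| = f x - f c := abs_of_pos (by linarith)
        simp only [levelIntegrand]
        rw [h4, if_pos ⟨by linarith, by linarith⟩, abs_of_nonneg h3]
    _ = ∫ x in c..e, deriv f x := by
        rw [intervalIntegral.integral_of_le hce.le, integral_Ioc_eq_integral_Ioo]
    _ = r := by
        rw [hf.lipschitzOnWith.absolutelyContinuousOnInterval.integral_deriv_eq_sub, hfe']
        ring

lemma setIntegral_Ioo_levelIntegrand_left {f : ℝ → ℝ} {L : NNReal}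
    (hf : LipschitzWith L f) {c d : ℝ} (hcd : c < d)
    (hmono : MonotoneOn f (Icc c d) ∨ AntitoneOn f (Icc c d))
    (hne : ∀ x ∈ Ioo c d, f x ≠ f c) :
    ∀ᶠ r in 𝓝[>] (0 : ℝ), ∫ x in Ioo c d, levelIntegrand f (f c) r x = r := by
  rcases hmono with h | h
  · exact setIntegral_Ioo_levelIntegrand_of_monotoneOn hf hcd h hne
  · have := setIntegral_Ioo_levelIntegrand_of_monotoneOn (f := fun z => -f z) hf.neg hcd h.neg
      (fun x hx => by simpa using hne x hx)
    simpa only [levelIntegrand_neg] using this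

lemma setIntegral_Ioo_levelIntegrand_right {f : ℝ → ℝ} {L : NNReal}
    (hf : LipschitzWith L f) {c d : ℝ} (hcd : c < d)
    (hmono : MonotoneOn f (Icc c d) ∨ AntitoneOn f (Icc c d))
    (hne : ∀ x ∈ Ioo c d, f x ≠ f d) :
    ∀ᶠ r in 𝓝[>] (0 : ℝ), ∫ x in Ioo c d, levelIntegrand f (f d) r x = r := by
  have hmaps : ∀ x ∈ Icc (-d) (-c), -x ∈ Icc c d := fun x hx =>
    ⟨by linarith [hx.2], by linarith [hx.1]⟩
  have hlip : LipschitzWith L fun z => f (-z) :=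
    LipschitzWith.of_dist_le_mul fun x z => by simpa using hf.dist_le_mul (-x) (-z)
  have := setIntegral_Ioo_levelIntegrand_left (f := fun z => f (-z)) hlip
    (neg_lt_neg hcd)
    (hmono.symm.imp
      (fun h x hx z hz hxz => h (hmaps z hz) (hmaps x hx) (neg_le_neg hxz))
      (fun h x hx z hz hxz => h (hmaps z hz) (hmaps x hx) (neg_le_neg hxz)))
    (fun x hx => by
      simpa using hne (-x) ⟨by linarith [hx.2], by linarith [hx.1]⟩)
  filter_upwards [this] with r hr
  simp only [levelIntegrand_comp_neg, neg_neg] at hr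
  rw [← integral_Ioc_eq_integral_Ioo, ← intervalIntegral.integral_of_le (neg_le_neg hcd.le),
    intervalIntegral.integral_comp_neg (levelIntegrand f (f d) r), neg_neg, neg_neg,
    intervalIntegral.integral_of_le hcd.le, integral_Ioc_eq_integral_Ioo] at hr
  exact hr

lemma eqOn_Icc_of_continuous_of_finite {f : ℝ → ℝ} (hf : Continuous f) {S : Set ℝ}
    (hS : S.Finite) {c d : ℝ} (h : ∀ x ∈ Icc c d, f x ∈ S) :
    ∀ x ∈ Icc c d, ∀ z ∈ Icc c d, f x = f z := fun _ hx _ hz =>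
  hS.countable.isTotallyDisconnected _ (image_subset_iff.2 h)
    (isPreconnected_Icc.image f hf.continuousOn) (mem_image_of_mem f hx) (mem_image_of_mem f hz)

/-- The one-sided neighbourhood of width `ε`, inside `(α₀, β₀)`, of the interval
`[xl j, xu j]`: to its right for `p = (j, true)` and to its left for `p = (j, false)`. -/
def sideNhd {m : ℕ} (α₀ β₀ : ℝ) (xl xu : Fin m → ℝ) (ε : ℝ) (p : Fin m × Bool) : Set ℝ :=
  (if p.2 then Ioo (xu p.1) (xu p.1 + ε) else Ioo (xl p.1 - ε) (xl p.1)) ∩ Ioo α₀ β₀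

/-- The side `p` of the interval `[xl j, xu j]` meets `(α₀, β₀)`. -/
def IsInnerSide {m : ℕ} (α₀ β₀ : ℝ) (xl xu : Fin m → ℝ) (p : Fin m × Bool) : Prop :=
  if p.2 then xu p.1 < β₀ else α₀ < xl p.1

section Sides

variable {m : ℕ} {α₀ β₀ : ℝ} {xl xu : Fin m → ℝ} {ε : ℝ}

lemma measurableSet_sideNhd (p : Fin m × Bool) :
    MeasurableSet (sideNhd α₀ β₀ xl xu ε p) := by
  unfold sideNhd
  split_ifs
  · exact measurableSet_Ioo.inter measurableSet_Ioo
  · exact measurableSet_Ioo.inter measurableSet_Ioo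

lemma pairwise_disjoint_sideNhd (hle : ∀ j, xl j ≤ xu j)
    (hsep : ∀ j k, j ≠ k → xu j + 2 * ε < xl k ∨ xu k + 2 * ε < xl j) :
    Pairwise (Function.onFun Disjoint (sideNhd α₀ β₀ xl xu ε)) := by
  rintro ⟨j, s⟩ ⟨k, u⟩ hne
  refine Set.disjoint_left.2 fun x hx hx' => ?_
  have hj := hle j
  have hk := hle k
  rcases eq_or_ne j k with rfl | hjk
  · cases s <;> cases u <;> simp [sideNhd] at hne hx hx' <;> linarith
  · rcases hsep j k hjk with h | h <;>
    cases s <;> cases u <;> simp [sideNhd] at hx hx' <;> linarith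

lemma two_mul_le_card_filter_isInnerSide_add_two (hsub : ∀ j, α₀ ≤ xl j ∧ xl j ≤ xu j ∧ xu j ≤ β₀)
    (hdisj : ∀ j k, j ≠ k → Disjoint (Icc (xl j) (xu j)) (Icc (xl k) (xu k))) :
    2 * m ≤ (Finset.univ.filter (IsInnerSide α₀ β₀ xl xu)).card + 2 := by
  have hout : (Finset.univ.filter fun p => ¬ IsInnerSide α₀ β₀ xl xu p).card ≤ 2 := by
    refine (Finset.card_le_card_of_injOn (t := (Finset.univ : Finset Bool)) Prod.snd
      (fun _ _ => Finset.mem_coe.2 (Finset.mem_univ _)) ?_).trans_eq (by simp)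
    rintro ⟨j, s⟩ hp ⟨k, u⟩ hq (rfl : s = u)
    by_contra hne
    have hjk : j ≠ k := fun h => hne (by rw [h])
    have hd := Set.disjoint_left.1 (hdisj j k hjk)
    obtain ⟨h1, h2, h3⟩ := hsub j
    obtain ⟨h4, h5, h6⟩ := hsub k
    replace hp := (Finset.mem_filter.1 (Finset.mem_coe.1 hp)).2
    replace hq := (Finset.mem_filter.1 (Finset.mem_coe.1 hq)).2
    cases s <;> simp [IsInnerSide] at hp hq
    · exact hd (a := α₀) ⟨by linarith, by linarith⟩ ⟨by linarith, by linarith⟩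
    · exact hd (a := β₀) ⟨by linarith, by linarith⟩ ⟨by linarith, by linarith⟩
  have htot := Finset.card_filter_add_card_filter_not (s := (Finset.univ : Finset (Fin m × Bool)))
    (IsInnerSide α₀ β₀ xl xu)
  simp at htot
  omega

end Sides

lemma eventually_setIntegral_levelIntegrand {m : ℕ} {α₀ β₀ : ℝ} {xl xu : Fin m → ℝ}
    {y : ℝ → ℝ} {L : NNReal} (hy : LipschitzWith L y) {ε : ℝ} (hε : 0 < ε) {c : ℝ}
    (hsub : ∀ j, α₀ ≤ xl j ∧ xl j ≤ xu j ∧ xu j ≤ β₀)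
    (hsep : ∀ j k, j ≠ k → xu j + 2 * ε < xl k ∨ xu k + 2 * ε < xl j)
    (hinner : ∀ j, y (xl j) = c → ∀ x ∈ Icc (xl j) (xu j), y x = c)
    (hlevel : ∀ x ∈ Icc α₀ β₀, y x = c → ∃ j, x ∈ Icc (xl j) (xu j) ∧ y (xl j) = c)
    (hR : ∀ j, xu j < β₀ → xu j + ε ≤ β₀ ∧
      (MonotoneOn y (Icc (xu j) (xu j + ε)) ∨ AntitoneOn y (Icc (xu j) (xu j + ε))))
    (hL : ∀ j, α₀ < xl j → α₀ ≤ xl j - ε ∧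
      (MonotoneOn y (Icc (xl j - ε) (xl j)) ∨ AntitoneOn y (Icc (xl j - ε) (xl j)))) :
    ∀ᶠ r in 𝓝[>] (0 : ℝ), ∫ x in Ioo α₀ β₀, levelIntegrand y c r x =
      ∑ p ∈ Finset.univ.filter (IsInnerSide α₀ β₀ xl xu) with y (xl p.1) = c, r := by
  have hside : ∀ p : Fin m × Bool, IsInnerSide α₀ β₀ xl xu p → y (xl p.1) = c →
      ∀ᶠ r in 𝓝[>] (0 : ℝ),
        ∫ x in sideNhd α₀ β₀ xl xu ε p, levelIntegrand y c r x = r := by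
    rintro ⟨j, s⟩ hp (hc : y (xl j) = c)
    obtain ⟨h1, h2, h3⟩ := hsub j
    have hcu : y (xu j) = c := hinner j hc _ (right_mem_Icc.2 h2)
    have havoid : ∀ x ∈ Icc α₀ β₀, x ∉ Icc (xl j) (xu j) → xl j - ε < x → x < xu j + ε →
        y x ≠ c := by
      intro x hx hxj hlx hxu hxc
      obtain ⟨k, hk, -⟩ := hlevel x hx hxc
      have hjk : j ≠ k := fun h => hxj (h ▸ hk)
      rcases hsep j k hjk with h | h
      · linarith [hk.1]
      · linarith [hk.2]
    cases s
    · replace hp : α₀ < xl j := by simpa [IsInnerSide] using hp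
      obtain ⟨h4, h5⟩ := hL j hp
      have hN : sideNhd α₀ β₀ xl xu ε (j, false) = Ioo (xl j - ε) (xl j) := by
        simp only [sideNhd, Bool.false_eq_true, if_false]
        exact inter_eq_left.2 (Ioo_subset_Ioo h4 (h2.trans h3))
      rw [hN]
      have := setIntegral_Ioo_levelIntegrand_right hy (by linarith) h5 fun x hx => hc ▸ havoid x
        ⟨by linarith [hx.1], by linarith [hx.2]⟩ (fun h => h.1.not_gt hx.2) hx.1
        (by linarith [hx.2])
      rwa [hc] at this
    · replace hp : xu j < β₀ := by simpa [IsInnerSide] using hp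
      obtain ⟨h4, h5⟩ := hR j hp
      have hN : sideNhd α₀ β₀ xl xu ε (j, true) = Ioo (xu j) (xu j + ε) := by
        simp only [sideNhd, if_true]
        exact inter_eq_left.2 (Ioo_subset_Ioo (h1.trans h2) h4)
      rw [hN]
      have := setIntegral_Ioo_levelIntegrand_left hy (by linarith) h5 fun x hx => hcu ▸ havoid x
        ⟨by linarith [hx.1], by linarith [hx.2]⟩ (fun h => h.2.not_gt hx.1)
        (by linarith [hx.1]) hx.2
      rwa [hcu] at this
  have hside' : ∀ᶠ r in 𝓝[>] (0 : ℝ), ∀ p : Fin m × Bool, IsInnerSide α₀ β₀ xl xu p →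
      y (xl p.1) = c → ∫ x in sideNhd α₀ β₀ xl xu ε p, levelIntegrand y c r x = r := by
    simpa only [eventually_all, eventually_imp_distrib_left] using hside
  have hcpt : IsCompact
      (Icc α₀ β₀ \ ⋃ j, ⋃ (_ : y (xl j) = c), Ioo (xl j - ε) (xu j + ε)) :=
    isCompact_Icc.diff (isOpen_iUnion fun _ => isOpen_iUnion fun _ => isOpen_Ioo)
  have hcont : Continuous fun x => |y x - c| := by
    have := hy.continuous
    fun_prop
  obtain ⟨δ, hδ, hδle⟩ := hcpt.exists_forall_le' hcont.continuousOn (a := 0) fun x hx => by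
    refine abs_pos.2 (sub_ne_zero.2 fun hxc => hx.2 ?_)
    obtain ⟨j, hj, hjc⟩ := hlevel x hx.1 hxc
    exact mem_iUnion₂.2 ⟨j, hjc, by linarith [hj.1], by linarith [hj.2]⟩
  filter_upwards [hside', Ioo_mem_nhdsGT hδ] with r hr hrδ
  set A := (Finset.univ.filter (IsInnerSide α₀ β₀ xl xu)).filter fun p => y (xl p.1) = c with hA
  have hAsub : (⋃ p ∈ A, sideNhd α₀ β₀ xl xu ε p) ⊆ Ioo α₀ β₀ :=
    iUnion₂_subset fun p _ => inter_subset_right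
  rw [setIntegral_eq_of_subset_of_forall_sdiff_eq_zero measurableSet_Ioo hAsub,
    integral_biUnion_finset]
  · refine Finset.sum_congr rfl fun p hp => ?_
    simp only [hA, Finset.mem_filter, Finset.mem_univ, true_and] at hp
    exact hr p hp.1 hp.2
  · exact fun p _ => measurableSet_sideNhd p
  · exact fun p _ q _ hpq => pairwise_disjoint_sideNhd (fun j => (hsub j).2.1) hsep hpq
  · intro p _
    refine integrableOn_levelIntegrand hy c r (ne_top_of_le_ne_top ?_
      (measure_mono (inter_subset_right : sideNhd α₀ β₀ xl xu ε p ⊆ Ioo α₀ β₀)))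
    simp
  · intro x ⟨hx, hxA⟩
    refine if_neg fun ⟨hpos, hle⟩ => ?_
    have hmem : x ∈ ⋃ j, ⋃ (_ : y (xl j) = c), Ioo (xl j - ε) (xu j + ε) := by
      by_contra hnot
      linarith [hδle x ⟨Ioo_subset_Icc_self hx, hnot⟩, hrδ.2]
    obtain ⟨j, hjc, hxj⟩ := mem_iUnion₂.1 hmem
    have hbetween : x ∈ Icc (xl j) (xu j) := by
      refine ⟨le_of_not_gt fun hlt => hxA (mem_iUnion₂.2 ⟨(j, false), ?_, ?_⟩),
        le_of_not_gt fun hlt => hxA (mem_iUnion₂.2 ⟨(j, true), ?_, ?_⟩)⟩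
      · simpa [hA, IsInnerSide, hjc] using hx.1.trans hlt
      · simpa [sideNhd, hlt, hx.1, hx.2] using hxj.1
      · simpa [hA, IsInnerSide, hjc] using hlt.trans hx.2
      · simpa [sideNhd, hlt, hx.1, hx.2] using hxj.2
    simp [hinner j hjc x hbetween] at hpos

/-- If `y` is Lipschitz, `y⁻¹(E_a) ∩ [α₀, β₀]` is the union of `m`
pairwise disjoint nonempty closed intervals `[x̲ j, x̄ j] ⊆ [α₀, β₀]`, `y` is piecewise
monotone next to the endpoints of these intervals, and all jumps `σ_i > 0`, then
`(m - 1)·min σ ≤ Σ(y) ≤ 2·m·max σ`. -/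
theorem jump_functional_finite_bounds
    (K : ℕ) (hK : 1 ≤ K)
    (t : ℕ → ℝ) (ht : ∀ i, 1 ≤ i → i < K → t i < t (i + 1))
    (a : ℕ → ℝ → ℝ) (ha : ∀ i ≤ K, ContDiff ℝ 1 (a i))
    (hmatch : ∀ i, 1 ≤ i → i ≤ K → a (i - 1) (t i) = a i (t i))
    (α₀ β₀ : ℝ) (hαβ : α₀ < β₀)
    (y : ℝ → ℝ) (hy : ∃ L : NNReal, LipschitzWith L y)
    (m : ℕ) (xl xu : Fin m → ℝ)
    (hsub : ∀ j, α₀ ≤ xl j ∧ xl j ≤ xu j ∧ xu j ≤ β₀)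
    (hdisj : ∀ j k, j ≠ k → Disjoint (Set.Icc (xl j) (xu j)) (Set.Icc (xl k) (xu k)))
    (hcover : {x | x ∈ Set.Icc α₀ β₀ ∧ ∃ i, 1 ≤ i ∧ i ≤ K ∧ y x = t i} =
      ⋃ j, Set.Icc (xl j) (xu j))
    (hmonoR : ∀ j, xu j < β₀ → ∃ ε : ℝ, 0 < ε ∧ xu j + ε ≤ β₀ ∧
      (MonotoneOn y (Set.Icc (xu j) (xu j + ε)) ∨ AntitoneOn y (Set.Icc (xu j) (xu j + ε))))
    (hmonoL : ∀ j, α₀ < xl j → ∃ ε : ℝ, 0 < ε ∧ α₀ ≤ xl j - ε ∧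
      (MonotoneOn y (Set.Icc (xl j - ε) (xl j)) ∨ AntitoneOn y (Set.Icc (xl j - ε) (xl j))))
    (hσpos : ∀ i, 1 ≤ i → i ≤ K → 0 < |deriv (a (i - 1)) (t i) - deriv (a i) (t i)|)
    (σmin σmax : ℝ)
    (hmin : IsLeast
      {s | ∃ i, 1 ≤ i ∧ i ≤ K ∧ s = |deriv (a (i - 1)) (t i) - deriv (a i) (t i)|} σmin)
    (hmax : IsGreatest
      {s | ∃ i, 1 ≤ i ∧ i ≤ K ∧ s = |deriv (a (i - 1)) (t i) - deriv (a i) (t i)|} σmax) :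
    ENNReal.ofReal (((m : ℝ) - 1) * σmin) ≤
      jumpFunctional K t (fun i => |deriv (a (i - 1)) (t i) - deriv (a i) (t i)|) α₀ β₀ y ∧
    jumpFunctional K t (fun i => |deriv (a (i - 1)) (t i) - deriv (a i) (t i)|) α₀ β₀ y ≤
      ENNReal.ofReal (2 * (m : ℝ) * σmax) := by
  obtain ⟨L, hy⟩ := hy
  set σ : ℕ → ℝ := fun i => |deriv (a (i - 1)) (t i) - deriv (a i) (t i)|
  have hσmem : ∀ i ∈ Finset.Icc 1 K, σmin ≤ σ i ∧ σ i ≤ σmax := fun i hi =>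
    have hi := Finset.mem_Icc.1 hi
    ⟨hmin.2 ⟨i, hi.1, hi.2, rfl⟩, hmax.2 ⟨i, hi.1, hi.2, rfl⟩⟩
  have hσmin : 0 < σmin := by
    obtain ⟨i, h1, h2, h3⟩ := hmin.1
    exact h3 ▸ hσpos i h1 h2
  have hσmax : 0 < σmax := by
    obtain ⟨i, h1, h2, h3⟩ := hmax.1
    exact h3 ▸ hσpos i h1 h2
  have htmono : StrictMonoOn t (Icc 1 K) :=
    strictMonoOn_of_lt_succ ordConnected_Icc fun i _ hi hi' => ht i hi.1 hi'.2
  have hmem : ∀ x, (∃ j, x ∈ Icc (xl j) (xu j)) ↔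
      x ∈ Icc α₀ β₀ ∧ ∃ i, 1 ≤ i ∧ i ≤ K ∧ y x = t i := fun x => by
    rw [← mem_iUnion, ← hcover]; rfl
  have hconst : ∀ j, ∀ x ∈ Icc (xl j) (xu j), y x = y (xl j) := by
    intro j x hx
    refine eqOn_Icc_of_continuous_of_finite hy.continuous ((finite_Icc 1 K).image t) ?_ x hx
      _ (left_mem_Icc.2 (hsub j).2.1)
    intro z hz
    obtain ⟨-, i, h1, h2, h3⟩ := (hmem z).1 ⟨j, hz⟩
    exact ⟨i, ⟨h1, h2⟩, h3.symm⟩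
  have hv : ∀ j, ∃ i, i ∈ Finset.Icc 1 K ∧ y (xl j) = t i := by
    intro j
    obtain ⟨-, i, h1, h2, h3⟩ := (hmem (xl j)).1 ⟨j, left_mem_Icc.2 (hsub j).2.1⟩
    exact ⟨i, Finset.mem_Icc.2 ⟨h1, h2⟩, h3⟩
  choose v hvK hvt using hv
  have hR : ∀ᶠ ε in 𝓝[>] (0 : ℝ), ∀ j, xu j < β₀ → xu j + ε ≤ β₀ ∧
      (MonotoneOn y (Icc (xu j) (xu j + ε)) ∨ AntitoneOn y (Icc (xu j) (xu j + ε))) := by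
    refine eventually_all.2 fun j => eventually_imp_distrib_left.2 fun hj => ?_
    obtain ⟨ε₀, h0, h1, h2⟩ := hmonoR j hj
    filter_upwards [Ioo_mem_nhdsGT h0] with ε hε
    have hss : Icc (xu j) (xu j + ε) ⊆ Icc (xu j) (xu j + ε₀) :=
      Icc_subset_Icc_right (by linarith [hε.2])
    exact ⟨by linarith [hε.2], h2.imp (·.mono hss) (·.mono hss)⟩
  have hL : ∀ᶠ ε in 𝓝[>] (0 : ℝ), ∀ j, α₀ < xl j → α₀ ≤ xl j - ε ∧
      (MonotoneOn y (Icc (xl j - ε) (xl j)) ∨ AntitoneOn y (Icc (xl j - ε) (xl j))) := by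
    refine eventually_all.2 fun j => eventually_imp_distrib_left.2 fun hj => ?_
    obtain ⟨ε₀, h0, h1, h2⟩ := hmonoL j hj
    filter_upwards [Ioo_mem_nhdsGT h0] with ε hε
    have hss : Icc (xl j - ε) (xl j) ⊆ Icc (xl j - ε₀) (xl j) :=
      Icc_subset_Icc_left (by linarith [hε.2])
    exact ⟨by linarith [hε.2], h2.imp (·.mono hss) (·.mono hss)⟩
  have hgap : ∀ᶠ ε in 𝓝[>] (0 : ℝ), ∀ j k, xu j < xl k → xu j + 2 * ε < xl k := by
    refine eventually_all.2 fun j => eventually_all.2 fun k =>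
      eventually_imp_distrib_left.2 fun hjk => ?_
    filter_upwards [Ioo_mem_nhdsGT (half_pos (sub_pos.2 hjk))] with ε hε
    linarith [hε.2]
  obtain ⟨ε, hεR, hεL, hεgap, hε⟩ :=
    (hR.and (hL.and (hgap.and (self_mem_nhdsWithin (s := Ioi (0 : ℝ)))))).exists
  have hsep : ∀ j k, j ≠ k → xu j + 2 * ε < xl k ∨ xu k + 2 * ε < xl j := by
    intro j k hjk
    refine Or.imp (hεgap j k) (hεgap k j) ?_
    by_contra! h
    have hd := Set.disjoint_left.1 (hdisj j k hjk)
    exact hd (a := max (xl j) (xl k))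
      ⟨le_max_left _ _, max_le (hsub j).2.1 h.1⟩ ⟨le_max_right _ _, max_le h.2 (hsub k).2.1⟩
  set A : Finset (Fin m × Bool) := Finset.univ.filter (IsInnerSide α₀ β₀ xl xu)
  have hint : ∀ᶠ r in 𝓝[>] (0 : ℝ), ∀ i ∈ Finset.Icc 1 K,
      ∫ x in Ioo α₀ β₀, levelIntegrand y (t i) r x = ∑ p ∈ A with y (xl p.1) = t i, r := by
    refine (Finset.eventually_all _).2 fun i hi => ?_
    have hi := Finset.mem_Icc.1 hi
    refine eventually_setIntegral_levelIntegrand hy hε hsub hsep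
      (fun j hj x hx => (hconst j x hx).trans hj) (fun x hx hxi => ?_) hεR hεL
    obtain ⟨j, hj⟩ := (hmem x).2 ⟨hx, i, hi.1, hi.2, hxi⟩
    exact ⟨j, hj, (hconst j x hj).symm.trans hxi⟩
  have hJ : jumpFunctional K t σ α₀ β₀ y = ENNReal.ofReal (∑ p ∈ A, σ (v p.1)) := by
    refine (limsup_congr ?_).trans (limsup_const _)
    filter_upwards [hint, self_mem_nhdsWithin] with r hr hr0
    have hr0 : r ≠ 0 := ne_of_gt hr0
    congr 1
    rw [← Finset.sum_fiberwise_of_maps_to (s := A) (t := Finset.Icc 1 K)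
      (g := fun p => v p.1) (fun p _ => hvK p.1), Finset.mul_sum]
    refine Finset.sum_congr rfl fun i hi => ?_
    have hfilter : (A.filter fun p => y (xl p.1) = t i) = A.filter fun p => v p.1 = i := by
      refine Finset.filter_congr fun p _ => ?_
      rw [hvt]
      exact htmono.injOn.eq_iff (by simpa using hvK p.1) (by simpa using hi)
    have hri := hr i hi
    simp only [levelIntegrand] at hri
    have hσi : ∑ p ∈ A with v p.1 = i, σ (v p.1) = ∑ p ∈ A with v p.1 = i, σ i :=
      Finset.sum_congr rfl fun p hp => by rw [(Finset.mem_filter.1 hp).2]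
    rw [hri, hfilter, hσi]
    simp only [Finset.sum_const, nsmul_eq_mul]
    field_simp
  have hcard : (A.card : ℝ) ≤ 2 * m := by
    have h : A.card ≤ 2 * m := (Finset.card_le_univ A).trans_eq (by simp [mul_comm])
    exact_mod_cast h
  have hcard' : (m : ℝ) - 1 ≤ A.card := by
    have h : 2 * m ≤ A.card + 2 :=
      two_mul_le_card_filter_isInnerSide_add_two hsub hdisj
    have h' : m ≤ A.card + 1 := by omega
    have : (m : ℝ) ≤ A.card + 1 := by exact_mod_cast h'
    linarith
  rw [hJ]
  refine ⟨ENNReal.ofReal_le_ofReal ?_, ENNReal.ofReal_le_ofReal ?_⟩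
  · calc ((m : ℝ) - 1) * σmin ≤ A.card * σmin := by gcongr
      _ = ∑ p ∈ A, σmin := by simp
      _ ≤ ∑ p ∈ A, σ (v p.1) := Finset.sum_le_sum fun p _ => (hσmem _ (hvK p.1)).1
  · calc ∑ p ∈ A, σ (v p.1) ≤ ∑ p ∈ A, σmax :=
          Finset.sum_le_sum fun p _ => (hσmem _ (hvK p.1)).2
      _ = A.card * σmax := by simp
      _ ≤ 2 * (m : ℝ) * σmax := by gcongr
end

section
/- Let (Ω, μ) be a measure space, g : ℝ → ℝ twice continuously differentiable, A ⊆ Ω a measurable set, and w ∈ L¹(μ). Let ȳ, z : Ω → ℝ be bounded measurable functions, let (s_n) be a sequence of positive reals with s_n → 0, and let y_n : Ω → ℝ be measurable functions with sup_{x ∈ Ω} |(y_n(x) − ȳ(x))/s_n − z(x)| → 0. Then (1/s_n²) ∫_A [ g(y_n(x)) − g(ȳ(x)) − g'(ȳ(x))·(y_n(x) − ȳ(x)) ]·w(x) dμ(x) → (1/2) ∫_A g''(ȳ(x))·z(x)²·w(x) dμ(x) as n → ∞. -/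
open Filter Set Topology MeasureTheory
open scoped ENNReal

/-- Second-order Taylor expansion of a `C²` function on `ℝ` with Lagrange remainder, for
arbitrary (possibly equal) endpoints. -/
theorem exists_taylor_lagrange_remainder_two {g : ℝ → ℝ} (hg : ContDiff ℝ 2 g) (a b : ℝ) :
    ∃ c ∈ uIcc a b,
      g b - g a - deriv g a * (b - a) = deriv (deriv g) c * (b - a) ^ 2 / 2 := by
  rcases eq_or_ne a b with rfl | hab
  · exact ⟨a, left_mem_uIcc, by simp⟩
  obtain ⟨c, hc, h⟩ := taylor_mean_remainder_lagrange_iteratedDeriv (n := 1) hab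
    (by simpa [one_add_one_eq_two] using hg.contDiffOn)
  refine ⟨c, uIoo_subset_uIcc_self hc, ?_⟩
  have hd : derivWithin g (uIcc a b) a = deriv g a :=
    (hg.differentiable (by norm_num) a).derivWithin
      (uniqueDiffOn_uIcc hab a left_mem_uIcc)
  rw [taylorWithinEval_succ, taylor_within_zero_eval] at h
  simp only [iteratedDeriv_succ, iteratedDeriv_zero, zero_add, iteratedDerivWithin_one, hd] at h
  norm_num at h
  linarith

/-- Smooth second-order Taylor limit: for `g ∈ C²(ℝ)`, a measurable set
`A`, `w ∈ L¹(μ)`, bounded measurable `ȳ, z`, positive `s n → 0`, and measurable `y n` with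
`sup_x |(y n x - ȳ x)/s n - z x| → 0`, one has
`(1/s n²) ∫_A (g(y n) - g(ȳ) - g'(ȳ)(y n - ȳ)) w dμ → (1/2) ∫_A g''(ȳ) z² w dμ`. -/
theorem smooth_second_order_taylor_limit
    {Ω : Type*} [MeasurableSpace Ω] (μ : Measure Ω)
    (g : ℝ → ℝ) (hg : ContDiff ℝ 2 g)
    (A : Set Ω) (hA : MeasurableSet A)
    (w : Ω → ℝ) (hw : Integrable w μ)
    (ybar z : Ω → ℝ)
    (hybm : Measurable ybar) (hybb : ∃ M : ℝ, ∀ x, |ybar x| ≤ M)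
    (hzm : Measurable z) (hzb : ∃ M : ℝ, ∀ x, |z x| ≤ M)
    (s : ℕ → ℝ) (hs : ∀ n, 0 < s n) (hs0 : Tendsto s atTop (𝓝 0))
    (y : ℕ → Ω → ℝ) (hym : ∀ n, Measurable (y n))
    (hconv : TendstoUniformly (fun n x => (y n x - ybar x) / s n) z atTop) :
    Tendsto (fun n => (1 / (s n) ^ 2) *
        ∫ x in A, (g (y n x) - g (ybar x) - deriv g (ybar x) * (y n x - ybar x)) * w x ∂μ)
      atTop
      (𝓝 ((1 / 2) * ∫ x in A, deriv (deriv g) (ybar x) * (z x) ^ 2 * w x ∂μ)) := by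
  obtain ⟨Y, hY⟩ := hybb
  obtain ⟨Z, hZ⟩ := hzb
  have hg1 : ContDiff ℝ 1 (deriv g) := hg.deriv' (n := 1)
  have hg2 : Continuous (deriv (deriv g)) := hg1.continuous_deriv le_rfl
  obtain ⟨C, hC⟩ := isCompact_Icc.exists_bound_of_continuousOn
    (hg2.continuousOn (s := Icc (-(Y + Z + 1)) (Y + Z + 1)))
  choose c hc hTaylor using fun n x => exists_taylor_lagrange_remainder_two hg (ybar x) (y n x)
  have hstep : ∀ n x, y n x - ybar x = s n * ((y n x - ybar x) / s n) := fun n x => by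
    rw [mul_div_cancel₀ _ (hs n).ne']
  have hc_sub : ∀ n x, |c n x - ybar x| ≤ |y n x - ybar x| := fun n x =>
    abs_sub_left_of_mem_uIcc (hc n x)
  have hrem : ∀ n x,
      1 / s n ^ 2 * ((g (y n x) - g (ybar x) - deriv g (ybar x) * (y n x - ybar x)) * w x) =
        1 / 2 * (deriv (deriv g) (c n x) * ((y n x - ybar x) / s n) ^ 2 * w x) := fun n x => by
    have := (hs n).ne'
    rw [hTaylor]
    field_simp
  simp_rw [← integral_const_mul]
  refine tendsto_integral_filter_of_dominated_convergence
    (fun x => 1 / 2 * (C * (Z + 1) ^ 2 * ‖w x‖)) (Eventually.of_forall fun n => ?_) ?_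
    ((hw.norm.restrict.const_mul _).const_mul _) (Eventually.of_forall fun x => ?_)
  · have hm : Measurable fun x =>
        g (y n x) - g (ybar x) - deriv g (ybar x) * (y n x - ybar x) :=
      ((hg.continuous.measurable.comp (hym n)).sub (hg.continuous.measurable.comp hybm)).sub
        ((hg1.continuous.measurable.comp hybm).mul ((hym n).sub hybm))
    exact (hm.aestronglyMeasurable.mul hw.1.restrict).const_mul _
  · filter_upwards [Metric.tendstoUniformly_iff.1 hconv 1 one_pos,
      hs0.eventually (gt_mem_nhds one_pos)] with n hn hsn
    refine Eventually.of_forall fun x => ?_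
    have hq : |(y n x - ybar x) / s n| ≤ Z + 1 := by
      have h1 := hn x
      rw [Real.dist_eq] at h1
      have h2 := hZ x
      rw [abs_lt] at h1
      rw [abs_le] at h2 ⊢
      constructor <;> linarith
    have hcb : |c n x - ybar x| ≤ Z + 1 := by
      refine (hc_sub n x).trans ?_
      rw [hstep, abs_mul, abs_of_pos (hs n)]
      exact (mul_le_of_le_one_left (abs_nonneg _) hsn.le).trans hq
    have hcC : ‖deriv (deriv g) (c n x)‖ ≤ C := by
      refine hC _ ?_
      have h2 := hY x
      rw [abs_le] at h2 hcb
      constructor <;> linarith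
    rw [hrem, norm_mul, norm_mul, norm_mul, norm_pow,
      Real.norm_of_nonneg (by norm_num : (0 : ℝ) ≤ 1 / 2)]
    have hC0 : 0 ≤ C := (norm_nonneg _).trans hcC
    rw [← Real.norm_eq_abs] at hq
    gcongr
  · simp_rw [hrem]
    have hq : Tendsto (fun n => (y n x - ybar x) / s n) atTop (𝓝 (z x)) := hconv.tendsto_at x
    have hy0 : Tendsto (fun n => |y n x - ybar x|) atTop (𝓝 0) := by
      simpa [← hstep] using (hs0.mul hq).abs
    have hcx : Tendsto (fun n => c n x) atTop (𝓝 (ybar x)) :=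
      tendsto_iff_dist_tendsto_zero.2
        (squeeze_zero (fun _ => dist_nonneg) (fun n => hc_sub n x) hy0)
    exact ((((hg2.tendsto _).comp hcx).mul (hq.pow 2)).mul_const _).const_mul _
end

section
/- Let (Ω, μ) be a measure space, w ∈ L¹(μ), t ∈ ℝ, δ > 0, and let f, g : ℝ → ℝ be twice continuously differentiable with f(t) = g(t). Let ȳ : Ω → ℝ be bounded measurable, let (s_n) be positive reals with s_n → 0, let C > 0, and let y_n : Ω → ℝ be measurable with sup_{x ∈ Ω} |y_n(x) − ȳ(x)| ≤ C·s_n for all n. Define B_n := {x ∈ Ω : t < ȳ(x) < t + δ and t − δ < y_n(x) ≤ t}. Then (1/s_n²) ∫_{B_n} | f(y_n(x)) − g(ȳ(x)) − g'(ȳ(x))·(y_n(x) − ȳ(x)) + (f'(t) − g'(t))·(t − y_n(x)) | · |w(x)| dμ(x) → 0 as n → ∞. -/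
open Filter Set Topology MeasureTheory
open scoped ENNReal

/-- Second-order Taylor bound, uniform on a compact interval, for a `C²` function. -/
theorem exists_taylor_bound_Icc {h : ℝ → ℝ} (hh : ContDiff ℝ 2 h) (a b : ℝ) :
    ∃ K : ℝ, 0 ≤ K ∧ ∀ x ∈ Icc a b, ∀ y ∈ Icc a b,
      |h y - h x - deriv h x * (y - x)| ≤ K * (y - x) ^ 2 := by
  have hd : Differentiable ℝ h := hh.differentiable (by norm_num)
  have hd1 : ContDiff ℝ 1 (deriv h) :=
    ((contDiff_succ_iff_deriv (n := 1)).1 (by simpa [one_add_one_eq_two] using hh)).2.2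
  have hdd : Differentiable ℝ (deriv h) := hd1.differentiable (by norm_num)
  have hc : Continuous (deriv (deriv h)) := hd1.continuous_deriv (by norm_num)
  obtain ⟨K, hK⟩ := isCompact_Icc.exists_bound_of_continuousOn (s := Icc a b) hc.continuousOn
  refine ⟨max K 0, le_max_right _ _, fun x hx y hy => ?_⟩
  have hsub : uIcc x y ⊆ Icc a b := uIcc_subset_Icc hx hy
  have key := (convex_uIcc x y).norm_image_sub_le_of_norm_hasDerivWithin_le
    (f := fun z => h z - deriv h x * z) (f' := fun z => deriv h z - deriv h x)
    (C := max K 0 * |y - x|)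
    (fun z _ => by
      simpa using ((hd z).hasDerivAt.fun_sub
        ((hasDerivAt_id z).const_mul (deriv h x))).hasDerivWithinAt)
    (fun z hz => by
      have h1 := (convex_Icc a b).norm_image_sub_le_of_norm_deriv_le (f := deriv h)
        (fun u _ => hdd u) hK hx (hsub hz)
      rw [Real.norm_eq_abs (z - x)] at h1
      exact h1.trans (mul_le_mul (le_max_left _ _) (abs_sub_left_of_mem_uIcc hz)
        (abs_nonneg _) (le_max_right _ _)))
    left_mem_uIcc right_mem_uIcc
  have e : h y - h x - deriv h x * (y - x)
      = (h y - deriv h x * y) - (h x - deriv h x * x) := by ring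
  rw [e, ← sq_abs (y - x), sq, ← mul_assoc]
  exact key

/-- The second-order remainder across a kink at `t` is quadratic in the step `|v - u|`. -/
theorem exists_kink_remainder_bound {f g : ℝ → ℝ} (hf : ContDiff ℝ 2 f) (hg : ContDiff ℝ 2 g)
    {t : ℝ} (hfg : f t = g t) (δ : ℝ) :
    ∃ K : ℝ, 0 ≤ K ∧ ∀ u v, t < u → u < t + δ → t - δ < v → v ≤ t →
      |f v - g u - deriv g u * (v - u) + (deriv f t - deriv g t) * (t - v)|
        ≤ K * (v - u) ^ 2 := by
  obtain ⟨K₁, hK₁, h₁⟩ := exists_taylor_bound_Icc hf (t - δ) (t + δ)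
  obtain ⟨K₂, hK₂, h₂⟩ := exists_taylor_bound_Icc hg (t - δ) (t + δ)
  refine ⟨K₁ + K₂ + K₂, by positivity, fun u v hu hu' hv hv' => ?_⟩
  have ht : t ∈ Icc (t - δ) (t + δ) := ⟨by linarith, by linarith⟩
  have hum : u ∈ Icc (t - δ) (t + δ) := ⟨by linarith, by linarith⟩
  have hvm : v ∈ Icc (t - δ) (t + δ) := ⟨by linarith, by linarith⟩
  have a₁ := h₁ t ht v hvm
  have a₂ := h₂ u hum v hvm
  have a₃ := h₂ t ht v hvm
  have hsq : (v - t) ^ 2 ≤ (v - u) ^ 2 := by nlinarith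
  have b₁ := a₁.trans (mul_le_mul_of_nonneg_left hsq hK₁)
  have b₃ := a₃.trans (mul_le_mul_of_nonneg_left hsq hK₂)
  rw [abs_le] at *
  constructor <;> linarith [b₁.1, b₁.2, a₂.1, a₂.2, b₃.1, b₃.2]

/-- Vanishing of the higher-order remainder across a kink: for
`f, g ∈ C²(ℝ)` with `f t = g t`, `w ∈ L¹(μ)`, bounded measurable `ȳ`, positive `s n → 0`,
and measurable `y n` with `sup_x |y n x - ȳ x| ≤ C·s n`, the integral over the transition
set `B n = {t < ȳ < t + δ, t - δ < y n ≤ t}` of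
`|f(y n) - g(ȳ) - g'(ȳ)(y n - ȳ) + (f'(t) - g'(t))(t - y n)|·|w|` is `o(s n²)`. -/
theorem kink_remainder_vanishes
    {Ω : Type*} [MeasurableSpace Ω] (μ : Measure Ω)
    (w : Ω → ℝ) (hw : Integrable w μ)
    (t δ : ℝ) (hδ : 0 < δ)
    (f g : ℝ → ℝ) (hf : ContDiff ℝ 2 f) (hg : ContDiff ℝ 2 g) (hfg : f t = g t)
    (ybar : Ω → ℝ) (hybm : Measurable ybar) (hybb : ∃ M : ℝ, ∀ x, |ybar x| ≤ M)
    (s : ℕ → ℝ) (hs : ∀ n, 0 < s n) (hs0 : Tendsto s atTop (𝓝 0))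
    (C : ℝ) (hC : 0 < C)
    (y : ℕ → Ω → ℝ) (hym : ∀ n, Measurable (y n))
    (hclose : ∀ n x, |y n x - ybar x| ≤ C * s n) :
    Tendsto (fun n => (1 / (s n) ^ 2) *
        ∫ x in {x | t < ybar x ∧ ybar x < t + δ ∧ t - δ < y n x ∧ y n x ≤ t},
          |f (y n x) - g (ybar x) - deriv g (ybar x) * (y n x - ybar x) +
            (deriv f t - deriv g t) * (t - y n x)| * |w x| ∂μ)
      atTop (𝓝 0) := by
  obtain ⟨K, hK0, hK⟩ := exists_kink_remainder_bound hf hg hfg δ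
  have hdg : Measurable (deriv g) := measurable_deriv g
  have hfm : Measurable f := hf.continuous.measurable
  have hgm : Measurable g := hg.continuous.measurable
  set B : ℕ → Set Ω := fun n =>
    {x | t < ybar x ∧ ybar x < t + δ ∧ t - δ < y n x ∧ y n x ≤ t} with hB
  have hBm : ∀ n, MeasurableSet (B n) := fun n =>
    (measurableSet_lt measurable_const hybm).inter
      ((measurableSet_lt hybm measurable_const).inter
        ((measurableSet_lt measurable_const (hym n)).inter
          (measurableSet_le (hym n) measurable_const)))
  set R : ℕ → Ω → ℝ := fun n x =>
    |f (y n x) - g (ybar x) - deriv g (ybar x) * (y n x - ybar x) +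
      (deriv f t - deriv g t) * (t - y n x)| with hR
  have hRm : ∀ n, Measurable (R n) := fun n => by
    have h1 := hfm.comp (hym n)
    have h2 := hgm.comp hybm
    have h3 := hdg.comp hybm
    exact (((h1.sub h2).sub (h3.mul ((hym n).sub hybm))).add
      ((measurable_const.sub (hym n)).const_mul _)).abs
  have hlim : Tendsto (fun n => ∫ x, (B n).indicator
      (fun x => 1 / s n ^ 2 * (R n x * |w x|)) x ∂μ) atTop (𝓝 (∫ _, (0 : ℝ) ∂μ)) := by
    refine tendsto_integral_of_dominated_convergence (fun x => K * C ^ 2 * |w x|)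
      (fun n => ?_) (hw.abs.const_mul _) (fun n => ae_of_all _ fun x => ?_)
      (ae_of_all _ fun x => ?_)
    · exact (((hRm n).aestronglyMeasurable.mul hw.abs.aestronglyMeasurable).const_mul
        _).indicator (hBm n)
    · by_cases hx : x ∈ B n
      · rw [indicator_of_mem hx]
        have h1 : R n x ≤ K * (y n x - ybar x) ^ 2 :=
          hK _ _ hx.1 hx.2.1 hx.2.2.1 hx.2.2.2
        have h2 : (y n x - ybar x) ^ 2 ≤ (C * s n) ^ 2 := by
          rw [← sq_abs (y n x - ybar x)]
          exact pow_le_pow_left₀ (abs_nonneg _) (hclose n x) 2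
        have h3 : 1 / s n ^ 2 * R n x ≤ K * C ^ 2 := by
          have hsn := hs n
          rw [one_div, inv_mul_le_iff₀ (by positivity)]
          calc R n x ≤ K * (C * s n) ^ 2 := h1.trans (mul_le_mul_of_nonneg_left h2 hK0)
            _ = s n ^ 2 * (K * C ^ 2) := by ring
        have h4 : 0 ≤ R n x := abs_nonneg _
        rw [Real.norm_of_nonneg (by positivity), ← mul_assoc]
        exact mul_le_mul_of_nonneg_right h3 (abs_nonneg _)
      · rw [indicator_of_notMem hx, norm_zero]
        positivity
    · refine tendsto_const_nhds.congr' ?_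
      have hev : ∀ᶠ n in atTop, x ∉ B n := by
        by_cases hx : t < ybar x
        · have hCs : Tendsto (fun n => C * s n) atTop (𝓝 0) := by
            simpa using hs0.const_mul C
          filter_upwards [hCs.eventually_lt_const (sub_pos.2 hx)] with n hn hxB
          linarith [(abs_le.1 (hclose n x)).1, hxB.2.2.2]
        · exact Eventually.of_forall fun n hxB => hx hxB.1
      filter_upwards [hev] with n hn
      rw [indicator_of_notMem hn]
  rw [integral_zero] at hlim
  refine hlim.congr fun n => ?_
  rw [integral_indicator (hBm n), integral_const_mul]
end
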